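/- Let m ≥ 1 and d ≥ 1. Let p₁, …, p_m be independent random polynomials in m real variables, each of the form p(x) = Σ a_{i₁…i_m} x₁^{i₁}⋯x_m^{i_m}, where the sum is over multi-indices with i₁ + ⋯ + i_m ≤ d, and where the coefficients a_{i₁…i_m} are independent centered normal random variables with variance equal to the multinomial coefficient d! / ( (d − Σ_k i_k)! · ∏_k i_k! ). Then the expected number of solutions x ∈ ℝ^m of the system p₁(x) = ⋯ = p_m(x) = 0 equals d^(m/2); moreover the density of real zeros at t ∈ ℝ^m is π^(−(m+1)/2)·Γ((m+1)/2)·d^(m/2)/(1 + t·t)^((m+1)/2). (Section 7.2.) -/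

import Mathlib

open MeasureTheory ProbabilityTheory Real Set
open scoped ENNReal NNReal

/-- A set on which a map is locally injective splits into countably many measurable pieces
on which the map is injective. -/
theorem exists_countable_partition_injOn {X Y : Type*} [TopologicalSpace X]
    [SecondCountableTopology X] [MeasurableSpace X] [BorelSpace X] {f : X → Y} {R : Set X}
    (hR : IsOpen R) (hf : ∀ p ∈ R, ∃ U ∈ nhds p, InjOn f U) :
    ∃ P : ℕ → Set X, (∀ n, MeasurableSet (P n)) ∧ Pairwise (Function.onFun Disjoint P) ∧
      (∀ n, InjOn f (P n)) ∧ ⋃ n, P n = R := by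
  rcases R.eq_empty_or_nonempty with rfl | hne
  · exact ⟨fun _ => ∅, by simp, by simp [Function.onFun, Pairwise], by simp, by simp⟩
  have h1 : ∀ p : X, ∃ U : Set X, IsOpen U ∧ (p ∈ R → p ∈ U ∧ InjOn f U ∧ U ⊆ R) := by
    intro p
    by_cases hp : p ∈ R
    · obtain ⟨U, hU, hinj⟩ := hf p hp
      obtain ⟨V, hVU, hV, hpV⟩ := mem_nhds_iff.1 hU
      exact ⟨V ∩ R, hV.inter hR, fun _ => ⟨⟨hpV, hp⟩, hinj.mono (inter_subset_left.trans hVU),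
        inter_subset_right⟩⟩
    · exact ⟨∅, isOpen_empty, fun h => absurd h hp⟩
  choose U hUo hU using h1
  obtain ⟨t, htR, htc, htU⟩ := TopologicalSpace.countable_cover_nhdsWithin
    (f := U) (s := R) (fun p hp => mem_nhdsWithin_of_mem_nhds ((hUo p).mem_nhds (hU p hp).1))
  have htne : t.Nonempty := by
    obtain ⟨p, hp⟩ := hne
    obtain ⟨q, hq, -⟩ := mem_iUnion₂.1 (htU hp)
    exact ⟨q, hq⟩
  obtain ⟨e, rfl⟩ := htc.exists_eq_range htne
  have he : ∀ n, e n ∈ R := fun n => htR ⟨n, rfl⟩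
  refine ⟨disjointed fun n => U (e n), fun n => MeasurableSet.disjointed
    (fun n => (hUo _).measurableSet) n, disjoint_disjointed _,
    fun n => ((hU _ (he n)).2.1).mono (disjointed_subset _ _), ?_⟩
  rw [iUnion_disjointed]
  refine Subset.antisymm (iUnion_subset fun n => (hU _ (he n)).2.2) ?_
  simpa using htU

theorem tsum_indicator_image_eq_encard {X Y : Type*} [MeasurableSpace X]
    {f : X → Y} {P : ℕ → Set X} (hP : ∀ n, MeasurableSet (P n))
    (hd : Pairwise (Function.onFun Disjoint P)) (hinj : ∀ n, InjOn f (P n)) {S : Set X} {q : Y}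
    (hS : S ⊆ ⋃ n, P n) (hm : MeasurableSet (S ∩ f ⁻¹' {q})) :
    ((S ∩ f ⁻¹' {q}).encard : ℝ≥0∞) = ∑' n, (f '' (P n ∩ S)).indicator 1 q := by
  rw [← Measure.count_apply hm]
  have : S ∩ f ⁻¹' {q} = ⋃ n, (S ∩ f ⁻¹' {q}) ∩ P n := by
    rw [← inter_iUnion, eq_comm, inter_eq_left]
    exact inter_subset_left.trans hS
  rw [this, measure_iUnion (fun i j h => (hd h).mono inter_subset_right inter_subset_right)
    (fun n => hm.inter (hP n))]
  congr 1
  ext n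
  rw [Measure.count_apply (hm.inter (hP n))]
  by_cases hq : q ∈ f '' (P n ∩ S)
  · rw [indicator_of_mem hq]
    obtain ⟨p, hp, rfl⟩ := hq
    have : S ∩ f ⁻¹' {f p} ∩ P n = {p} := by
      ext p'
      simp only [mem_inter_iff, mem_preimage, mem_singleton_iff]
      refine ⟨fun h => hinj n h.2 hp.1 h.1.2, ?_⟩
      rintro rfl
      exact ⟨⟨hp.2, rfl⟩, hp.1⟩
    simp [this]
  · rw [indicator_of_notMem hq]
    have : S ∩ f ⁻¹' {q} ∩ P n = ∅ := by
      ext p'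
      simp only [mem_inter_iff, mem_preimage, mem_singleton_iff, mem_empty_iff_false, iff_false]
      exact fun h => hq ⟨p', ⟨h.2, h.1.1⟩, h.1.2⟩
    simp [this]

section ParametrizedFiber

variable {Ω E : Type*} [NormedAddCommGroup Ω] [NormedSpace ℝ Ω] [FiniteDimensional ℝ Ω]
  [NormedAddCommGroup E] [NormedSpace ℝ E] [FiniteDimensional ℝ E]

theorem exists_injOn_nhds_prodMk_of_det_ne_zero {g : Ω × E → E} (hg : ContDiff ℝ 1 g)
    {G : Ω × E → E →L[ℝ] E} (hG : ∀ p, HasFDerivAt (fun x => g (p.1, x)) (G p) p.2)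
    {p : Ω × E} (hp : (G p).det ≠ 0) :
    ∃ U ∈ nhds p, InjOn (fun q : Ω × E => (q.1, g q)) U := by
  have hs : HasStrictFDerivAt (fun q : Ω × E => (q.1, g q))
      ((ContinuousLinearMap.fst ℝ Ω E).prod (fderiv ℝ g p)) p :=
    hasStrictFDerivAt_fst.prodMk (hg.contDiffAt.hasStrictFDerivAt (by simp))
  have hGp : G p = (fderiv ℝ g p).comp (ContinuousLinearMap.inr ℝ Ω E) := by
    refine (hG p).unique ?_
    have h1 : HasFDerivAt g (fderiv ℝ g p) (p.1, p.2) :=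
      (hg.contDiffAt.differentiableAt (by simp)).hasFDerivAt
    exact h1.comp p.2 (hasFDerivAt_prodMk_right p.1 p.2)
  set T := (ContinuousLinearMap.fst ℝ Ω E).prod (fderiv ℝ g p) with hT
  have hinj : Function.Injective (T : Ω × E →ₗ[ℝ] Ω × E) := by
    rw [← LinearMap.ker_eq_bot, LinearMap.ker_eq_bot']
    rintro ⟨a, b⟩ hab
    simp only [hT, ContinuousLinearMap.coe_coe, ContinuousLinearMap.prod_apply,
      ContinuousLinearMap.coe_fst', Prod.mk_eq_zero] at hab
    obtain ⟨rfl, hb⟩ := hab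
    have hb' : G p b = 0 := by rw [hGp]; simpa using hb
    have hGi : Function.Injective (G p : E →ₗ[ℝ] E) :=
      ((LinearMap.isUnit_iff_isUnit_det _).2 (isUnit_iff_ne_zero.2 hp) |>
        (Module.End.isUnit_iff _).1).1
    have : b = 0 := hGi (by simpa using hb')
    simp [this]
  let e := (LinearEquiv.ofInjectiveEndo (T : Ω × E →ₗ[ℝ] Ω × E) hinj).toContinuousLinearEquiv
  have he : (e : Ω × E →L[ℝ] Ω × E) = T := by
    ext x <;> rfl
  rw [← he] at hs
  exact ⟨_, (hs.toOpenPartialHomeomorph _).open_source.mem_nhds hs.mem_toOpenPartialHomeomorph_source,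
    (hs.toOpenPartialHomeomorph _).injOn⟩

variable [MeasurableSpace Ω] [BorelSpace Ω] [MeasurableSpace E] [BorelSpace E]

/-- Kac–Rice formula: the expected number of solutions in `I` of `g (ω, x) = y`, for independent
`ω` and `y` with `y` of density `φ`. -/
theorem lintegral_encard_fiber (μ : Measure E) [μ.IsAddHaarMeasure] (ν : Measure Ω)
    [SFinite ν] {φ : E → ℝ≥0∞} (hφ : Measurable φ)
    {g : Ω × E → E} (hg : ContDiff ℝ 1 g)
    {G : Ω × E → E →L[ℝ] E} (hG : ∀ p, HasFDerivAt (fun x => g (p.1, x)) (G p) p.2)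
    {I : Set E} (hI : MeasurableSet I) :
    ∫⁻ q, ({x | x ∈ I ∧ g (q.1, x) = q.2}.encard : ℝ≥0∞) ∂(ν.prod (μ.withDensity φ)) =
      ∫⁻ x in I, ∫⁻ ω, ENNReal.ofReal |(G (ω, x)).det| * φ (g (ω, x)) ∂ν ∂μ := by
  have hGe : G = fun p => (fderiv ℝ g p).comp (ContinuousLinearMap.inr ℝ Ω E) := by
    ext1 p
    refine (hG p).unique ?_
    have h1 : HasFDerivAt g (fderiv ℝ g p) (p.1, p.2) :=
      (hg.contDiffAt.differentiableAt (by simp)).hasFDerivAt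
    exact h1.comp p.2 (hasFDerivAt_prodMk_right p.1 p.2)
  have hGc : Continuous G := by
    rw [hGe]
    exact (hg.continuous_fderiv (by simp)).clm_comp continuous_const
  have hdet : Continuous fun p => (G p).det := ContinuousLinearMap.continuous_det.comp hGc
  have hgc : Continuous g := hg.continuous
  set Φ : Ω × E → Ω × E := fun q => (q.1, g q) with hΦ
  have hΦc : Continuous Φ := continuous_fst.prodMk hgc
  set R : Set (Ω × E) := {p | (G p).det ≠ 0} with hR
  have hRo : IsOpen R := isOpen_ne_fun hdet continuous_const
  obtain ⟨P, hPm, hPd, hPi, hPU⟩ := exists_countable_partition_injOn hRo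
    (fun p hp => exists_injOn_nhds_prodMk_of_det_ne_zero hg hG hp)
  set S : Set (Ω × E) := {p | p.2 ∈ I} with hSdef
  have hS : MeasurableSet S := measurable_snd hI
  set ψ : Ω × E → ℝ≥0∞ := fun p => ENNReal.ofReal |(G p).det| * φ (g p) with hψ
  have hψm : Measurable ψ :=
    (ENNReal.measurable_ofReal.comp (continuous_abs.comp hdet).measurable).mul
      (hφ.comp hgc.measurable)
  -- the critical values form a null set
  have hCm : MeasurableSet (Φ '' Rᶜ) := by
    obtain ⟨K, hK, hKU⟩ :=
      (isSigmaCompact_univ.of_isClosed_subset hRo.isClosed_compl (subset_univ _)).image hΦc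
    exact hKU ▸ MeasurableSet.iUnion fun n => (hK n).measurableSet
  have hC0 : (ν.prod (μ.withDensity φ)) (Φ '' Rᶜ) = 0 := by
    rw [Measure.measure_prod_null hCm]
    refine Filter.Eventually.of_forall fun ω => withDensity_absolutelyContinuous _ _ ?_
    have hsub : Prod.mk ω ⁻¹' (Φ '' Rᶜ) ⊆ (fun x => g (ω, x)) '' {x | (G (ω, x)).det = 0} := by
      rintro y ⟨⟨a, b⟩, hab, h⟩
      simp only [hΦ, Prod.mk.injEq] at h
      obtain ⟨rfl, rfl⟩ := h
      exact ⟨b, by simpa [hR] using hab, rfl⟩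
    refine measure_mono_null hsub ?_
    exact addHaar_image_eq_zero_of_det_fderivWithin_eq_zero μ (f' := fun x => G (ω, x))
      (fun x _ => (hG (ω, x)).hasFDerivWithinAt) (fun x hx => hx)
  have hIm : ∀ n, MeasurableSet (Φ '' (P n ∩ S)) := fun n =>
    ((hPm n).inter hS).image_of_continuousOn_injOn hΦc.continuousOn
      ((hPi n).mono inter_subset_left)
  have hcount : ∀ᵐ q ∂(ν.prod (μ.withDensity φ)),
      ({x | x ∈ I ∧ g (q.1, x) = q.2}.encard : ℝ≥0∞) =
        ∑' n, (Φ '' (P n ∩ S)).indicator 1 q := by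
    filter_upwards [measure_eq_zero_iff_ae_notMem.1 hC0] with q hq
    have h1 : (S ∩ R) ∩ Φ ⁻¹' {q} = Prod.mk q.1 '' {x | x ∈ I ∧ g (q.1, x) = q.2} := by
      ext ⟨a, b⟩
      simp only [hSdef, hΦ, mem_inter_iff, mem_ofPred_eq, mem_preimage, mem_singleton_iff,
        mem_image, Prod.mk.injEq]
      constructor
      · rintro ⟨⟨h1, h2⟩, h3⟩
        subst h3
        exact ⟨b, ⟨h1, rfl⟩, rfl, rfl⟩
      · rintro ⟨x, ⟨h1, h2⟩, rfl, rfl⟩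
        refine ⟨⟨h1, ?_⟩, by rw [h2]⟩
        by_contra hc
        exact hq ⟨(q.1, x), hc, by simp [hΦ, h2]⟩
    rw [← (Prod.mk_right_injective q.1).encard_image, ← h1,
      tsum_indicator_image_eq_encard hPm hPd hPi (by rw [hPU]; exact inter_subset_right)
      ((hS.inter hRo.measurableSet).inter (hΦc.measurable (measurableSet_singleton q)))]
    congr 1
    ext n
    have hPR : P n ⊆ R := hPU ▸ subset_iUnion P n
    rw [← inter_assoc, inter_eq_left.2 (inter_subset_left.trans hPR)]
  rw [lintegral_congr_ae hcount, lintegral_tsum fun n => (measurable_one.indicator (hIm n)).aemeasurable]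
  have hterm : ∀ n, ∫⁻ q, (Φ '' (P n ∩ S)).indicator 1 q ∂(ν.prod (μ.withDensity φ)) =
      ∫⁻ ω, ∫⁻ x, (P n ∩ S).indicator ψ (ω, x) ∂μ ∂ν := by
    intro n
    rw [lintegral_indicator_one (hIm n), Measure.prod_apply (hIm n)]
    refine lintegral_congr fun ω => ?_
    have hsec : MeasurableSet {x | (ω, x) ∈ P n ∩ S} :=
      measurable_prodMk_left ((hPm n).inter hS)
    have himg : Prod.mk ω ⁻¹' (Φ '' (P n ∩ S)) =
        (fun x => g (ω, x)) '' {x | (ω, x) ∈ P n ∩ S} := by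
      ext y
      constructor
      · rintro ⟨⟨a, b⟩, hab, h⟩
        simp only [hΦ, Prod.mk.injEq] at h
        obtain ⟨rfl, rfl⟩ := h
        exact ⟨b, hab, rfl⟩
      · rintro ⟨x, hx, rfl⟩
        exact ⟨(ω, x), hx, rfl⟩
    rw [withDensity_apply _ (measurable_prodMk_left (hIm n)), himg,
      lintegral_image_eq_lintegral_abs_det_fderiv_mul μ hsec
        (f' := fun x => G (ω, x)) (fun x _ => (hG (ω, x)).hasFDerivWithinAt),
      ← lintegral_indicator hsec]
    · rfl
    · intro x hx y hy hxy
      have := hPi n hx.1 hy.1 (by simpa [hΦ] using hxy)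
      exact (Prod.mk.inj this).2
  simp_rw [hterm]
  have hm1 : ∀ n, Measurable ((P n ∩ S).indicator ψ) := fun n =>
    hψm.indicator ((hPm n).inter hS)
  rw [← lintegral_tsum fun n => ((hm1 n).lintegral_prod_right').aemeasurable]
  have : ∀ ω, ∑' n, ∫⁻ x, (P n ∩ S).indicator ψ (ω, x) ∂μ = ∫⁻ x in I, ψ (ω, x) ∂μ := by
    intro ω
    have hm2 : ∀ n, Measurable fun x => (P n ∩ S).indicator ψ (ω, x) := fun n =>
      (hm1 n).comp measurable_prodMk_left
    rw [← lintegral_tsum fun n => (hm2 n).aemeasurable, ← lintegral_indicator hI]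
    refine lintegral_congr fun x => ?_
    by_cases hx : x ∈ I
    · rw [indicator_of_mem hx]
      by_cases hr : (ω, x) ∈ R
      · obtain ⟨n, hn⟩ := mem_iUnion.1 (hPU.symm ▸ hr : (ω, x) ∈ ⋃ n, P n)
        have hmem : (ω, x) ∈ P n ∩ S := ⟨hn, hx⟩
        rw [tsum_eq_single n, indicator_of_mem hmem]
        intro k hk
        rw [indicator_of_notMem]
        exact fun h => (hPd hk).le_bot ⟨h.1, hn⟩
      · have h0 : ψ (ω, x) = 0 := by
          have : (G (ω, x)).det = 0 := by simpa [hR] using hr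
          simp [hψ, this]
        simp [h0]
    · rw [indicator_of_notMem hx]
      simp [hSdef, hx]
  simp_rw [this]
  rw [lintegral_lintegral_swap hψm.aemeasurable]

end ParametrizedFiber

theorem lintegral_pi_prod_eq_prod_lintegral {X : Type*} [MeasurableSpace X] {n : ℕ}
    (μ : Fin n → Measure X) [∀ i, SigmaFinite (μ i)] {f : Fin n → X → ℝ≥0∞}
    (hf : ∀ i, Measurable (f i)) :
    ∫⁻ x, ∏ i, f i (x i) ∂(Measure.pi μ) = ∏ i, ∫⁻ x, f i x ∂(μ i) := by
  induction n with
  | zero => simp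
  | succ n ih =>
    have h := measurePreserving_piFinSuccAbove μ 0
    rw [← h.symm.lintegral_comp_emb (MeasurableEquiv.measurableEmbedding _), Fin.prod_univ_succ,
      ← ih (fun i => μ i.succ) (fun i => hf i.succ)]
    simp only [Fin.prod_univ_succ, MeasurableEquiv.piFinSuccAbove_symm_apply, Fin.insertNthEquiv_zero, Fin.consEquiv_apply,
      Fin.cons_zero, Fin.cons_succ, Fin.succAbove_zero]
    exact lintegral_prod_mul (μ := μ 0) (ν := Measure.pi fun i : Fin n => μ i.succ)
      (hf 0).aemeasurable (Finset.measurable_prod _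
      fun i _ => (hf _).comp (measurable_pi_apply i)).aemeasurable

theorem pi_withDensity_eq {X : Type*} [MeasurableSpace X] {n : ℕ}
    (ρ : Measure X) [SigmaFinite ρ] {f : X → ℝ≥0∞} [SigmaFinite (ρ.withDensity f)]
    (hf : Measurable f) :
    Measure.pi (fun _ : Fin n => ρ.withDensity f) =
      (Measure.pi fun _ : Fin n => ρ).withDensity (fun x => ∏ j, f (x j)) := by
  refine Measure.pi_eq fun s hs => ?_
  rw [withDensity_apply _ (MeasurableSet.univ_pi hs), Measure.restrict_pi_pi,
    lintegral_pi_prod_eq_prod_lintegral _ fun _ => hf]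
  exact Finset.prod_congr rfl fun i _ => (withDensity_apply _ (hs i)).symm

theorem integral_cexp_sum_pi_gaussianReal {ι : Type*} [Fintype ι] (σ : ι → ℝ≥0) (t : ι → ℝ) :
    ∫ B : ι → ℝ, Complex.exp ((∑ i, t i * B i : ℝ) * Complex.I)
        ∂(Measure.pi fun i => gaussianReal 0 (σ i)) =
      ((rexp (-(∑ i, σ i * t i ^ 2) / 2) : ℝ) : ℂ) := by
  have h : ∀ B : ι → ℝ, Complex.exp ((∑ i, t i * B i : ℝ) * Complex.I) =
      ∏ i, Complex.exp (t i * B i * Complex.I) := by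
    intro B
    rw [← Complex.exp_sum]
    congr 1
    push_cast
    rw [Finset.sum_mul]
  simp_rw [h]
  rw [integral_fintype_prod_eq_prod (f := fun i (b : ℝ) => Complex.exp (t i * b * Complex.I))]
  simp_rw [← charFun_apply_real, charFun_gaussianReal]
  rw [← Complex.exp_sum, Complex.ofReal_exp]
  congr 1
  push_cast
  rw [neg_div, Finset.sum_div, ← Finset.sum_neg_distrib]
  refine Finset.sum_congr rfl fun i _ => ?_
  simp

theorem integral_exp_quadratic_gaussianReal {K : ℝ} (hK : 0 < K) (c M : ℝ) :
    ∫ s, rexp (-((K - 1) * s ^ 2 + 2 * s * c + M) / 2) ∂(gaussianReal 0 1) =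
      (√K)⁻¹ * rexp (-(M - c ^ 2 / K) / 2) := by
  rw [integral_gaussianReal_eq_integral_smul (by norm_num)]
  have h : ∀ s : ℝ, gaussianPDFReal 0 1 s • rexp (-((K - 1) * s ^ 2 + 2 * s * c + M) / 2) =
      ((√(2 * π))⁻¹ * rexp (-(M - c ^ 2 / K) / 2)) * rexp (-(K / 2) * (s + c / K) ^ 2) := by
    intro s
    simp only [gaussianPDFReal, smul_eq_mul, NNReal.coe_one, mul_one]
    have h1 : rexp (-(s - 0) ^ 2 / 2) * rexp (-((K - 1) * s ^ 2 + 2 * s * c + M) / 2) =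
        rexp (-(M - c ^ 2 / K) / 2) * rexp (-(K / 2) * (s + c / K) ^ 2) := by
      rw [← Real.exp_add, ← Real.exp_add]
      congr 1
      field_simp
      ring
    linear_combination (√(2 * π))⁻¹ * h1
  simp_rw [h]
  rw [integral_const_mul, integral_add_right_eq_self (fun s => rexp (-(K / 2) * s ^ 2)),
    integral_gaussian]
  have h2 : √(π / (K / 2)) = √(2 * π) * (√K)⁻¹ := by
    rw [← Real.sqrt_inv, ← Real.sqrt_mul (by positivity)]
    congr 1
    field_simp
  rw [h2]
  field_simp

theorem map_withDensity_gaussianPDF_eq {X : Type*} [MeasurableSpace X] {m : ℕ} (ρ : Measure X)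
    [IsProbabilityMeasure ρ] {u : X → ℝ} {v : X → Fin m → ℝ} (hu : Measurable u)
    (hv : Measurable v) {K : ℝ} (hK : 0 < K) {c M : (Fin m → ℝ) → ℝ} {L : Matrix (Fin m) (Fin m) ℝ}
    (hchar : ∀ s ξ, ∫ x, Complex.exp ((s * u x + ∑ k, ξ k * v x k : ℝ) * Complex.I) ∂ρ =
      ((rexp (-((K - 1) * s ^ 2 + 2 * s * c ξ + M ξ) / 2) : ℝ) : ℂ))
    (hL : ∀ ξ, ∑ l, (Matrix.vecMul ξ L l) ^ 2 = M ξ - c ξ ^ 2 / K) :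
    (ρ.withDensity fun x => gaussianPDF 0 1 (u x)).map v =
      ENNReal.ofReal (√(2 * π * K))⁻¹ •
        (Measure.pi fun _ : Fin m => gaussianReal 0 1).map L.mulVec := by
  have hbd : ∀ x, gaussianPDF 0 1 x ≤ ENNReal.ofReal (√(2 * π))⁻¹ := by
    intro x
    rw [gaussianPDF]
    refine ENNReal.ofReal_le_ofReal ?_
    rw [gaussianPDFReal]
    simp only [NNReal.coe_one, mul_one]
    refine mul_le_of_le_one_right (by positivity) ?_
    rw [Real.exp_le_one_iff]
    have := sq_nonneg (x - 0)
    linarith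
  have hdm : Measurable fun x => gaussianPDF 0 1 (u x) := (measurable_gaussianPDF 0 1).comp hu
  have hfin : IsFiniteMeasure (ρ.withDensity fun x => gaussianPDF 0 1 (u x)) := by
    refine isFiniteMeasure_withDensity ?_
    refine ((lintegral_mono fun x => hbd (u x)).trans_lt ?_).ne
    rw [lintegral_const, measure_univ, mul_one]
    exact ENNReal.ofReal_lt_top
  have hLm : Measurable L.mulVec := (Continuous.matrix_mulVec continuous_const continuous_id).measurable
  have hprob : IsProbabilityMeasure
      ((Measure.pi fun _ : Fin m => gaussianReal 0 1).map L.mulVec) :=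
    Measure.isProbabilityMeasure_map hLm.aemeasurable
  have hfin2 : IsFiniteMeasure (ENNReal.ofReal (√(2 * π * K))⁻¹ •
      (Measure.pi fun _ : Fin m => gaussianReal 0 1).map L.mulVec) :=
    Measure.smul_finite _ ENNReal.ofReal_ne_top
  refine Measure.ext_of_charFunDual (funext fun T => ?_)
  set ξ : Fin m → ℝ := fun k => T (Pi.single k 1) with hξ
  have hT : ∀ w, T w = ∑ k, ξ k * w k := by
    intro w
    conv_lhs => rw [pi_eq_sum_univ' w]
    simp [hξ, mul_comm]
  simp_rw [charFunDual_apply]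
  rw [integral_map hv.aemeasurable (by fun_prop), integral_smul_measure,
    integral_map hLm.aemeasurable (by fun_prop)]
  have hr : ∀ g : Fin m → ℝ, ((T (L.mulVec g) : ℝ) : ℂ) = ((∑ l, Matrix.vecMul ξ L l * g l : ℝ) : ℂ) := by
    intro g
    congr 1
    rw [hT]
    exact Matrix.dotProduct_mulVec ξ L g
  simp_rw [hr]
  rw [integral_cexp_sum_pi_gaussianReal (fun _ => 1)]
  simp only [NNReal.coe_one, one_mul, hL]
  rw [integral_withDensity_eq_integral_toReal_smul hdm
    (Filter.Eventually.of_forall fun x => (hbd _).trans_lt ENNReal.ofReal_lt_top)]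
  have hpdf : ∀ x, (gaussianPDF 0 1 (u x)).toReal • Complex.exp ((T (v x) : ℝ) * Complex.I) =
      ((√(2 * π))⁻¹ : ℝ) * ∫ s : ℝ, Complex.exp ((s * u x + ∑ k, ξ k * v x k : ℝ) * Complex.I)
        ∂(gaussianReal 0 1) := by
    intro x
    have h1 : ∀ s : ℝ, Complex.exp ((s * u x + ∑ k, ξ k * v x k : ℝ) * Complex.I) =
        Complex.exp ((u x : ℂ) * s * Complex.I) * Complex.exp ((T (v x) : ℝ) * Complex.I) := by
      intro s
      rw [← Complex.exp_add, hT]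
      congr 1
      push_cast
      ring
    simp_rw [h1]
    rw [integral_mul_const, ← charFun_apply_real, charFun_gaussianReal, toReal_gaussianPDF,
      gaussianPDFReal, Complex.real_smul]
    push_cast
    simp only [mul_zero, zero_mul, zero_sub, sub_zero, one_mul, mul_one]
    rw [← neg_div]
    ring
  simp_rw [hpdf]
  rw [integral_const_mul, integral_integral_swap]
  · simp_rw [hchar]
    rw [integral_complex_ofReal, integral_exp_quadratic_gaussianReal hK, Complex.real_smul,
      ← Complex.ofReal_mul, ← Complex.ofReal_mul]
    congr 1
    rw [ENNReal.toReal_ofReal (by positivity), ← mul_assoc]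
    congr 1
    rw [Real.sqrt_mul (by positivity) K, mul_inv]
  · refine Integrable.of_bound (C := 1) ?_ (Filter.Eventually.of_forall fun p => ?_)
    · refine Measurable.aestronglyMeasurable ?_
      simp only [Function.uncurry_def]
      fun_prop
    · simp only [Function.uncurry_def]
      rw [Complex.norm_exp_ofReal_mul_I]

/-- The expected absolute determinant of a square matrix with independent standard Gaussian
entries. -/
noncomputable def gaussianAbsDet (m : ℕ) : ℝ≥0∞ :=
  ∫⁻ A : Fin m → Fin m → ℝ, ENNReal.ofReal |(Matrix.of A).det|
    ∂(Measure.pi fun _ => Measure.pi fun _ => gaussianReal 0 1)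

theorem measurable_ofReal_abs_det (m : ℕ) :
    Measurable fun A : Fin m → Fin m → ℝ => ENNReal.ofReal |(Matrix.of A).det| := by
  have : Continuous fun A : Fin m → Fin m → ℝ => (Matrix.of A).det :=
    Continuous.matrix_det continuous_id
  exact ENNReal.measurable_ofReal.comp this.abs.measurable

theorem pi_const_smul {X : Type*} [MeasurableSpace X] {m : ℕ} (μ : Measure X) [IsFiniteMeasure μ]
    {c : ℝ≥0∞} (hc : c ≠ ∞) :
    Measure.pi (fun _ : Fin m => c • μ) = c ^ m • Measure.pi fun _ : Fin m => μ := by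
  have : IsFiniteMeasure (c • μ) := Measure.smul_finite _ hc
  refine Measure.pi_eq fun s _ => ?_
  simp [Measure.pi_pi, Finset.prod_mul_distrib]

theorem lintegral_abs_det_mul_prod_gaussianPDF {X : Type*} [MeasurableSpace X] {m : ℕ}
    (ρ : Measure X) [IsProbabilityMeasure ρ] {u : X → ℝ} {v : X → Fin m → ℝ} (hu : Measurable u)
    (hv : Measurable v) {b : ℝ} {L : Matrix (Fin m) (Fin m) ℝ}
    (hmap : (ρ.withDensity fun x => gaussianPDF 0 1 (u x)).map v =
      ENNReal.ofReal b • (Measure.pi fun _ : Fin m => gaussianReal 0 1).map L.mulVec) :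
    ∫⁻ B : Fin m → X, ENNReal.ofReal |(Matrix.of fun j => v (B j)).det| *
        ∏ j, gaussianPDF 0 1 (u (B j)) ∂(Measure.pi fun _ => ρ) =
      ENNReal.ofReal b ^ m * ENNReal.ofReal |L.det| * gaussianAbsDet m := by
  have hdm : Measurable fun x => gaussianPDF 0 1 (u x) := (measurable_gaussianPDF 0 1).comp hu
  have hLm : Measurable L.mulVec :=
    (Continuous.matrix_mulVec continuous_const continuous_id).measurable
  have hprob : IsProbabilityMeasure
      ((Measure.pi fun _ : Fin m => gaussianReal 0 1).map L.mulVec) :=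
    Measure.isProbabilityMeasure_map hLm.aemeasurable
  have hfin2 : IsFiniteMeasure (ENNReal.ofReal b •
      (Measure.pi fun _ : Fin m => gaussianReal 0 1).map L.mulVec) :=
    Measure.smul_finite _ ENNReal.ofReal_ne_top
  have hfin3 : IsFiniteMeasure ((ρ.withDensity fun x => gaussianPDF 0 1 (u x)).map v) :=
    hmap ▸ hfin2
  have hfin : IsFiniteMeasure (ρ.withDensity fun x => gaussianPDF 0 1 (u x)) :=
    (Measure.isFiniteMeasure_map_iff hv.aemeasurable).1 hfin3
  have hdet := measurable_ofReal_abs_det m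
  have hvm : Measurable fun (B : Fin m → X) j => v (B j) :=
    measurable_pi_lambda _ fun j => hv.comp (measurable_pi_apply j)
  have hLm' : Measurable fun (A : Fin m → Fin m → ℝ) j => L.mulVec (A j) :=
    measurable_pi_lambda _ fun j => hLm.comp (measurable_pi_apply j)
  calc _ = ∫⁻ B : Fin m → X, ENNReal.ofReal |(Matrix.of fun j => v (B j)).det|
          ∂((Measure.pi fun _ : Fin m => ρ).withDensity
            fun B => ∏ j, gaussianPDF 0 1 (u (B j))) := by
        have hprod : Measurable fun B : Fin m → X => ∏ j, gaussianPDF 0 1 (u (B j)) :=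
          Finset.measurable_prod _ fun i _ => hdm.comp (measurable_pi_apply i)
        have hcomp : Measurable fun B : Fin m → X =>
          ENNReal.ofReal |(Matrix.of fun j => v (B j)).det| := hdet.comp hvm
        rw [lintegral_withDensity_eq_lintegral_mul _ hprod hcomp]
        simp only [Pi.mul_apply, mul_comm]
    _ = ∫⁻ A : Fin m → Fin m → ℝ, ENNReal.ofReal |(Matrix.of A).det|
          ∂(Measure.pi fun _ => (ρ.withDensity fun x => gaussianPDF 0 1 (u x)).map v) := by
        rw [← pi_withDensity_eq ρ hdm, ← Measure.pi_map_pi (fun _ => hv.aemeasurable),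
          lintegral_map hdet hvm]
    _ = ENNReal.ofReal b ^ m * ∫⁻ A : Fin m → Fin m → ℝ,
          ENNReal.ofReal |(Matrix.of fun j => L.mulVec (A j)).det|
          ∂(Measure.pi fun _ => Measure.pi fun _ => gaussianReal 0 1) := by
        simp_rw [hmap]
        rw [pi_const_smul _ ENNReal.ofReal_ne_top, lintegral_smul_measure, smul_eq_mul,
          ← Measure.pi_map_pi (fun _ => hLm.aemeasurable), lintegral_map hdet hLm']
    _ = _ := by
        rw [mul_assoc, gaussianAbsDet, ← lintegral_const_mul _ hdet]
        congr 1
        refine lintegral_congr fun A => ?_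
        have : (Matrix.of fun j => L.mulVec (A j)) = Matrix.of A * L.transpose := by
          ext j k
          simp only [Matrix.of_apply, Matrix.mulVec, Matrix.mul_apply, Matrix.transpose_apply,
            dotProduct]
          exact Finset.sum_congr rfl fun i _ => mul_comm _ _
        rw [this, Matrix.det_mul, Matrix.det_transpose, abs_mul,
          ENNReal.ofReal_mul (abs_nonneg _), mul_comm]

/-- A symmetric square root of `1 - (1 + x ⬝ x)⁻¹ x xᵀ`. -/
noncomputable def sqrtProj {m : ℕ} (x : Fin m → ℝ) : Matrix (Fin m) (Fin m) ℝ :=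
  1 - ((1 + ∑ k, x k ^ 2) + √(1 + ∑ k, x k ^ 2))⁻¹ • Matrix.vecMulVec x x

theorem det_sqrtProj {m : ℕ} (x : Fin m → ℝ) :
    (sqrtProj x).det = (√(1 + ∑ k, x k ^ 2))⁻¹ := by
  set r := 1 + ∑ k, x k ^ 2 with hr
  have hr0 : 0 < r := by
    have : 0 ≤ ∑ k, x k ^ 2 := Finset.sum_nonneg fun k _ => sq_nonneg _
    linarith
  have hs : 0 < √r := Real.sqrt_pos.2 hr0
  have h1 : sqrtProj x = 1 + Matrix.replicateCol Unit (-(r + √r)⁻¹ • x) *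
      Matrix.replicateRow Unit x := by
    ext i j
    simp [sqrtProj, Matrix.vecMulVec, Matrix.mul_apply, ← hr, sub_eq_add_neg]
    ring
  rw [h1, Matrix.det_one_add_replicateCol_mul_replicateRow]
  have h2 : x ⬝ᵥ (-(r + √r)⁻¹ • x) = -(r + √r)⁻¹ * (r - 1) := by
    rw [dotProduct_smul, smul_eq_mul]
    congr 1
    rw [hr, add_sub_cancel_left, dotProduct]
    exact Finset.sum_congr rfl fun i _ => (sq _).symm
  rw [h2]
  have hsq : √r ^ 2 = r := Real.sq_sqrt hr0.le
  clear_value r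
  generalize √r = q at *
  subst hsq
  field_simp
  ring

theorem sum_vecMul_sqrtProj_sq {m : ℕ} (x ξ : Fin m → ℝ) :
    ∑ l, (Matrix.vecMul ξ (sqrtProj x) l) ^ 2 =
      ∑ k, ξ k ^ 2 - (∑ k, x k * ξ k) ^ 2 / (1 + ∑ k, x k ^ 2) := by
  set r := 1 + ∑ k, x k ^ 2 with hr
  have hr0 : 0 < r := by
    have : 0 ≤ ∑ k, x k ^ 2 := Finset.sum_nonneg fun k _ => sq_nonneg _
    linarith
  have hs : 0 < √r := Real.sqrt_pos.2 hr0
  set z := ∑ k, x k * ξ k with hz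
  have h1 : ∀ l, Matrix.vecMul ξ (sqrtProj x) l = ξ l - (r + √r)⁻¹ * z * x l := by
    intro l
    rw [sqrtProj, Matrix.vecMul_sub, Matrix.vecMul_one, Matrix.vecMul_smul, Pi.sub_apply,
      Pi.smul_apply, smul_eq_mul, ← hr, mul_assoc]
    congr 2
    simp only [Matrix.vecMul, dotProduct, Matrix.vecMulVec_apply, hz, Finset.sum_mul]
    exact Finset.sum_congr rfl fun i _ => by ring
  simp_rw [h1]
  have h2 : ∀ w : ℝ, ∑ l, (ξ l - w * x l) ^ 2 =
      ∑ k, ξ k ^ 2 - 2 * w * z + w ^ 2 * (r - 1) := by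
    intro w
    have : r - 1 = ∑ k, x k ^ 2 := by rw [hr]; ring
    rw [this, hz, Finset.mul_sum, Finset.mul_sum]
    rw [← Finset.sum_sub_distrib, ← Finset.sum_add_distrib]
    exact Finset.sum_congr rfl fun i _ => by ring
  rw [h2]
  have hsq : √r ^ 2 = r := Real.sq_sqrt hr0.le
  clear_value r z
  generalize √r = q at *
  subst hsq
  field_simp
  ring

theorem volume_det_eq_zero (m : ℕ) :
    volume {A : Fin m → Fin m → ℝ | (Matrix.of A).det = 0} = 0 := by
  set S := {A : Fin m → Fin m → ℝ | (Matrix.of A).det = 0} with hS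
  have hdet : Continuous fun A : Fin m → Fin m → ℝ => (Matrix.of A).det :=
    Continuous.matrix_det continuous_id
  have hSm : MeasurableSet S := (isClosed_eq hdet continuous_const).measurableSet
  set D : ℝ → Fin m → Fin m → ℝ := fun t => Matrix.scalar (Fin m) t with hD
  have hDc : Continuous D := by
    refine continuous_pi fun i => continuous_pi fun j => ?_
    simp only [hD, Matrix.scalar_apply, Matrix.diagonal_apply]
    split_ifs <;> fun_prop
  have h1 : ∀ t, volume S = ∫⁻ A, S.indicator 1 (D t - A) := by
    intro t
    rw [← lintegral_indicator_one hSm]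
    exact (lintegral_sub_left_eq_self (μ := volume) (S.indicator (1 : (Fin m → Fin m → ℝ) → ℝ≥0∞)) (D t)).symm
  have h2 : ∀ A : Fin m → Fin m → ℝ, ∫⁻ t, S.indicator (1 : (Fin m → Fin m → ℝ) → ℝ≥0∞) (D t - A) = 0 := by
    intro A
    have hsub : {t : ℝ | D t - A ∈ S} ⊆ (Matrix.of A).charpoly.rootSet ℝ := by
      intro t ht
      rw [Polynomial.mem_rootSet]
      refine ⟨(Matrix.charpoly_monic _).ne_zero, ?_⟩
      rw [Polynomial.aeval_def, Algebra.algebraMap_self, Polynomial.eval₂_id, Matrix.eval_charpoly]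
      exact ht
    have hfin := ((Matrix.of A).charpoly.rootSet_finite ℝ).subset hsub
    have : ∀ t, S.indicator (1 : (Fin m → Fin m → ℝ) → ℝ≥0∞) (D t - A) =
        {t : ℝ | D t - A ∈ S}.indicator 1 t := fun t => rfl
    rw [lintegral_congr this, lintegral_indicator_one hfin.measurableSet]
    exact hfin.measure_zero _
  have h3 : ∫⁻ _ : ℝ, volume S = 0 := by
    rw [lintegral_congr h1, lintegral_lintegral_swap]
    · simp [h2]
    · refine Measurable.aemeasurable ?_
      exact (measurable_one.indicator hSm).comp
        ((hDc.comp continuous_fst).sub continuous_snd).measurable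
  simpa using h3

theorem pi_gaussianReal_eq_withDensity (m : ℕ) :
    (Measure.pi fun _ : Fin m => gaussianReal 0 1) =
      (volume : Measure (Fin m → ℝ)).withDensity (fun x => ∏ j, gaussianPDF 0 1 (x j)) := by
  have h0 : gaussianReal 0 1 = volume.withDensity (gaussianPDF 0 1) :=
    gaussianReal_of_var_ne_zero _ one_ne_zero
  have : SigmaFinite (volume.withDensity (gaussianPDF 0 1)) := h0 ▸ inferInstance
  rw [h0, pi_withDensity_eq _ (measurable_gaussianPDF 0 1)]
  rfl

theorem measurable_prod_gaussianPDF (m : ℕ) :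
    Measurable fun y : Fin m → ℝ => ∏ j, gaussianPDF 0 1 (y j) :=
  Finset.measurable_prod _ fun i _ => (measurable_gaussianPDF 0 1).comp (measurable_pi_apply i)

theorem pi_pi_gaussianReal_absolutelyContinuous (m : ℕ) :
    (Measure.pi fun _ : Fin m => Measure.pi fun _ : Fin m => gaussianReal 0 1) ≪ volume := by
  have h1 := pi_gaussianReal_eq_withDensity m
  have : SigmaFinite ((volume : Measure (Fin m → ℝ)).withDensity
      (fun x => ∏ j, gaussianPDF 0 1 (x j))) := h1 ▸ inferInstance
  rw [h1, pi_withDensity_eq _ (measurable_prod_gaussianPDF m)]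
  exact withDensity_absolutelyContinuous _ _

theorem lintegral_one_add_sum_sq_rpow (m : ℕ) :
    ∫⁻ x : Fin m → ℝ, ENNReal.ofReal ((1 + ∑ k, x k ^ 2) ^ (-((m + 1) / 2 : ℝ))) =
      ENNReal.ofReal (π ^ ((m + 1) / 2 : ℝ) / Real.Gamma ((m + 1) / 2)) := by
  have hp : (0 : ℝ) < (m + 1) / 2 := by positivity
  have hΓ : 0 < Real.Gamma ((m + 1) / 2) := Real.Gamma_pos_of_pos hp
  have hg : ∀ {a r : ℝ}, 0 < a → 0 < r → ∫⁻ t in Ioi (0 : ℝ), ENNReal.ofReal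
      (t ^ (a - 1) * rexp (-(r * t))) = ENNReal.ofReal ((1 / r) ^ a * Real.Gamma a) := by
    intro a r ha hr
    rw [← Real.integral_rpow_mul_exp_neg_mul_Ioi ha hr, ofReal_integral_eq_lintegral_ofReal]
    · refine not_imp_comm.1 integral_undef ?_
      rw [Real.integral_rpow_mul_exp_neg_mul_Ioi ha hr]
      have := Real.Gamma_pos_of_pos ha
      positivity
    · refine (ae_restrict_mem measurableSet_Ioi).mono fun t ht => ?_
      have : (0 : ℝ) < t := ht
      positivity
  have hx : ∀ x : Fin m → ℝ, 0 < 1 + ∑ k, x k ^ 2 := fun x => by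
    have : 0 ≤ ∑ k, x k ^ 2 := Finset.sum_nonneg fun k _ => sq_nonneg _
    linarith
  have h1 : ∀ x : Fin m → ℝ, ENNReal.ofReal ((1 + ∑ k, x k ^ 2) ^ (-((m + 1) / 2 : ℝ))) =
      ENNReal.ofReal (Real.Gamma ((m + 1) / 2))⁻¹ * ∫⁻ t in Ioi (0 : ℝ), ENNReal.ofReal
        (t ^ ((m + 1) / 2 - 1 : ℝ) * rexp (-((1 + ∑ k, x k ^ 2) * t))) := by
    intro x
    rw [hg hp (hx x), ← ENNReal.ofReal_mul (by positivity)]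
    congr 1
    rw [one_div, Real.inv_rpow (hx x).le, Real.rpow_neg (hx x).le]
    field_simp
  have hgauss : ∀ t : ℝ, 0 < t → ∫⁻ y : ℝ, ENNReal.ofReal (rexp (-t * y ^ 2)) =
      ENNReal.ofReal (√(π / t)) := by
    intro t ht
    rw [← integral_gaussian, ofReal_integral_eq_lintegral_ofReal (integrable_exp_neg_mul_sq ht)
      (Filter.Eventually.of_forall fun y => (Real.exp_pos _).le)]
  have h2 : ∀ t ∈ Ioi (0 : ℝ), ∫⁻ x : Fin m → ℝ, ENNReal.ofReal
        (t ^ ((m + 1) / 2 - 1 : ℝ) * rexp (-((1 + ∑ k, x k ^ 2) * t))) =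
      ENNReal.ofReal (π ^ (m / 2 : ℝ)) *
        ENNReal.ofReal (t ^ ((1 / 2 : ℝ) - 1) * rexp (-(1 * t))) := by
    intro t ht
    have ht : 0 < t := ht
    have h3 : ∀ x : Fin m → ℝ, ENNReal.ofReal
        (t ^ ((m + 1) / 2 - 1 : ℝ) * rexp (-((1 + ∑ k, x k ^ 2) * t))) =
        ENNReal.ofReal (t ^ ((m + 1) / 2 - 1 : ℝ) * rexp (-t)) *
          ∏ k, ENNReal.ofReal (rexp (-t * x k ^ 2)) := by
      intro x
      rw [← ENNReal.ofReal_prod_of_nonneg fun k _ => (Real.exp_pos _).le,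
        ← ENNReal.ofReal_mul (by positivity), ← Real.exp_sum, mul_assoc, ← Real.exp_add,
        ← Finset.mul_sum]
      congr 3
      ring
    simp_rw [h3]
    rw [lintegral_const_mul _ (by fun_prop), volume_pi,
      lintegral_pi_prod_eq_prod_lintegral (f := fun _ y => ENNReal.ofReal (rexp (-t * y ^ 2))) _
        (fun _ => by fun_prop), hgauss t ht, Finset.prod_const, Finset.card_univ, Fintype.card_fin,
      ← ENNReal.ofReal_pow (by positivity), ← ENNReal.ofReal_mul (by positivity),
      ← ENNReal.ofReal_mul (by positivity)]
    congr 1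
    rw [Real.sqrt_eq_rpow, ← Real.rpow_natCast, ← Real.rpow_mul (by positivity),
      Real.div_rpow pi_pos.le ht.le]
    have h4 : t ^ ((m + 1) / 2 - 1 : ℝ) = t ^ ((1 / 2 : ℝ) - 1) * t ^ (1 / 2 * m : ℝ) := by
      rw [← Real.rpow_add ht]
      congr 1
      ring
    have h5 : (1 / 2 * m : ℝ) = m / 2 := by ring
    rw [h4, h5]
    have : t ^ (m / 2 : ℝ) ≠ 0 := (Real.rpow_pos_of_pos ht _).ne'
    field_simp
  simp_rw [h1]
  rw [lintegral_const_mul' _ _ ENNReal.ofReal_ne_top, lintegral_lintegral_swap,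
    setLIntegral_congr_fun measurableSet_Ioi h2, lintegral_const_mul' _ _ ENNReal.ofReal_ne_top,
    hg (by norm_num) one_pos, Real.Gamma_one_half_eq, ← ENNReal.ofReal_mul (by positivity),
    ← ENNReal.ofReal_mul (by positivity)]
  · congr 1
    have h6 : π ^ ((m + 1) / 2 : ℝ) = π ^ (m / 2 : ℝ) * √π := by
      rw [Real.sqrt_eq_rpow, ← Real.rpow_add pi_pos]
      congr 1
      ring
    rw [h6]
    simp
    field_simp
  · refine Measurable.aemeasurable ?_
    simp only [Function.uncurry_def]
    fun_prop

theorem lintegral_prod_gaussianPDF (m : ℕ) :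
    ∫⁻ y : Fin m → ℝ, ∏ j, gaussianPDF 0 1 (y j) = 1 := by
  rw [volume_pi, lintegral_pi_prod_eq_prod_lintegral _ fun _ => measurable_gaussianPDF 0 1]
  simp [lintegral_gaussianPDF_eq_one]

theorem lintegral_abs_det_mul_prod_gaussianPDF_mulVec {m : ℕ} {A : Matrix (Fin m) (Fin m) ℝ}
    (hA : A.det ≠ 0) :
    ∫⁻ x : Fin m → ℝ, ENNReal.ofReal |A.det| * ∏ j, gaussianPDF 0 1 (A.mulVec x j) = 1 := by
  have h := Real.map_matrix_volume_pi_eq_smul_volume_pi hA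
  have hc : Continuous (Matrix.toLin' A) := LinearMap.continuous_of_finiteDimensional _
  have h2 : ∫⁻ x : Fin m → ℝ, ∏ j, gaussianPDF 0 1 (A.mulVec x j) =
      ENNReal.ofReal |A.det⁻¹| := by
    rw [← mul_one (ENNReal.ofReal _), ← lintegral_prod_gaussianPDF m, ← smul_eq_mul,
      ← lintegral_smul_measure, ← h, lintegral_map (measurable_prod_gaussianPDF m) hc.measurable]
    rfl
  rw [lintegral_const_mul' _ _ ENNReal.ofReal_ne_top, h2, ← ENNReal.ofReal_mul (abs_nonneg _),
    ← abs_mul, mul_inv_cancel₀ hA]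
  simp

/-- The zero density at `x` of the random affine system `y + A x = 0`, with `A` and `y` standard
Gaussian. -/
theorem lintegral_abs_det_mul_prod_gaussianPDF_linear {m : ℕ} (x : Fin m → ℝ) :
    ∫⁻ A : Fin m → Fin m → ℝ, ENNReal.ofReal |(Matrix.of A).det| *
        ∏ j, gaussianPDF 0 1 ((Matrix.of A).mulVec x j)
        ∂(Measure.pi fun _ => Measure.pi fun _ => gaussianReal 0 1) =
      ENNReal.ofReal (√(2 * π))⁻¹ ^ m * gaussianAbsDet m *
        ENNReal.ofReal ((1 + ∑ k, x k ^ 2) ^ (-((m + 1) / 2 : ℝ))) := by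
  set r := 1 + ∑ k, x k ^ 2 with hr
  have hr0 : 0 < r := by
    have : 0 ≤ ∑ k, x k ^ 2 := Finset.sum_nonneg fun k _ => sq_nonneg _
    linarith
  have hu : Measurable fun G : Fin m → ℝ => G ⬝ᵥ x := by
    unfold dotProduct
    fun_prop
  have hmap := map_withDensity_gaussianPDF_eq (Measure.pi fun _ : Fin m => gaussianReal 0 1)
    hu measurable_id hr0
    (c := fun ξ => ∑ k, x k * ξ k) (M := fun ξ => ∑ k, ξ k ^ 2) (L := sqrtProj x) ?_
    (sum_vecMul_sqrtProj_sq x)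
  · have h := lintegral_abs_det_mul_prod_gaussianPDF _ hu measurable_id hmap
    refine h.trans ?_
    rw [det_sqrtProj, ← hr, mul_right_comm _ (gaussianAbsDet m),
      ← ENNReal.ofReal_pow (by positivity), ← ENNReal.ofReal_pow (by positivity),
      ← ENNReal.ofReal_mul (by positivity), ← ENNReal.ofReal_mul (by positivity)]
    congr 2
    rw [abs_of_nonneg (by positivity), Real.sqrt_mul (by positivity), mul_inv, mul_pow, mul_assoc]
    congr 1
    rw [← pow_succ, Real.sqrt_eq_rpow, ← Real.rpow_neg hr0.le, ← Real.rpow_natCast,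
      ← Real.rpow_mul hr0.le]
    congr 1
    push_cast
    ring
  · intro s ξ
    have h := integral_cexp_sum_pi_gaussianReal (fun _ : Fin m => 1) fun k => s * x k + ξ k
    convert h using 3
    · congr 3
      simp only [dotProduct, Finset.mul_sum, ← Finset.sum_add_distrib, id]
      exact Finset.sum_congr rfl fun k _ => by ring
    · congr 3
      rw [hr]
      simp only [NNReal.coe_one, one_mul, add_sub_cancel_left, Finset.sum_mul, Finset.mul_sum,
        ← Finset.sum_add_distrib]
      exact Finset.sum_congr rfl fun k _ => by ring

theorem gaussianAbsDet_eq (m : ℕ) :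
    ENNReal.ofReal (√(2 * π))⁻¹ ^ m * gaussianAbsDet m =
      ENNReal.ofReal (Real.Gamma ((m + 1) / 2) / π ^ ((m + 1) / 2 : ℝ)) := by
  have hΓ : 0 < Real.Gamma ((m + 1) / 2) := Real.Gamma_pos_of_pos (by positivity)
  have hI : 0 < π ^ ((m + 1) / 2 : ℝ) / Real.Gamma ((m + 1) / 2) := by positivity
  have hne : ∀ᵐ A ∂(Measure.pi fun _ : Fin m => Measure.pi fun _ : Fin m => gaussianReal 0 1),
      (Matrix.of A).det ≠ 0 := by
    rw [ae_iff]
    simpa using pi_pi_gaussianReal_absolutelyContinuous m (volume_det_eq_zero m)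
  have h1 : ∫⁻ x : Fin m → ℝ, ∫⁻ A : Fin m → Fin m → ℝ, ENNReal.ofReal |(Matrix.of A).det| *
        ∏ j, gaussianPDF 0 1 ((Matrix.of A).mulVec x j)
        ∂(Measure.pi fun _ => Measure.pi fun _ => gaussianReal 0 1) = 1 := by
    rw [lintegral_lintegral_swap, lintegral_congr_ae
      (hne.mono fun A hA => lintegral_abs_det_mul_prod_gaussianPDF_mulVec hA)]
    · simp
    · refine Measurable.aemeasurable ?_
      refine ((measurable_ofReal_abs_det m).comp measurable_snd).mul ?_
      refine (measurable_prod_gaussianPDF m).comp (measurable_pi_lambda _ fun j => ?_)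
      simp only [Matrix.mulVec, dotProduct, Matrix.of_apply]
      fun_prop
  rw [lintegral_congr lintegral_abs_det_mul_prod_gaussianPDF_linear,
    lintegral_const_mul _ (by fun_prop), lintegral_one_add_sum_sq_rpow] at h1
  rw [ENNReal.eq_inv_of_mul_eq_one_left h1, ← ENNReal.ofReal_inv_of_pos hI, inv_div]

/-- The multinomial coefficient `d! / ((d - |α|)! ∏ αₖ!)`, and `0` if `|α| > d`. -/
noncomputable def multinomialVar {m : ℕ} (d : ℕ) (α : Fin m → Fin (d + 1)) : ℝ≥0 :=
  if ∑ k, (α k : ℕ) ≤ d then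
    (d.factorial : ℝ≥0) /
      (((d - ∑ k, (α k : ℕ)).factorial : ℝ≥0) * ∏ k, ((α k : ℕ).factorial : ℝ≥0))
  else 0

/-- The monomial `x ^ α` if `|α| ≤ d`, and `0` otherwise. -/
def mon {m d : ℕ} (α : Fin m → Fin (d + 1)) (x : Fin m → ℝ) : ℝ :=
  if ∑ k, (α k : ℕ) ≤ d then ∏ k, x k ^ (α k : ℕ) else 0

theorem contDiff_mon {m d : ℕ} (α : Fin m → Fin (d + 1)) : ContDiff ℝ 2 (mon α) := by
  unfold mon
  split_ifs <;> fun_prop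

theorem mon_zero {m d : ℕ} : mon (0 : Fin m → Fin (d + 1)) = fun _ => 1 := by
  funext x
  simp [mon]

theorem multinomialVar_zero {m : ℕ} (d : ℕ) : multinomialVar d (0 : Fin m → Fin (d + 1)) = 1 := by
  have : (d.factorial : ℝ≥0) ≠ 0 := by exact_mod_cast d.factorial_ne_zero
  simp [multinomialVar, this]

theorem sum_multinomialVar_mul_mon {m : ℕ} (d : ℕ) (z : Fin m → ℝ) :
    ∑ α : Fin m → Fin (d + 1), multinomialVar d α * mon α z = (1 + ∑ k, z k) ^ d := by
  have h1 : (1 + ∑ k, z k) = ∑ o : Option (Fin m), o.elim 1 z := by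
    simp [Fintype.sum_option]
  have h2 : ∑ α : Fin m → Fin (d + 1), multinomialVar d α * mon α z =
      ∑ α : Fin m → Fin (d + 1) with ∑ k, (α k : ℕ) ≤ d, multinomialVar d α * mon α z := by
    rw [Finset.sum_filter_of_ne]
    intro α _ h
    by_contra hα
    exact h (by simp [multinomialVar, hα])
  rw [h1, Finset.sum_pow_eq_sum_piAntidiag, h2]
  refine Finset.sum_bij' (fun α _ o => o.elim (d - ∑ k, (α k : ℕ)) fun k => α k)
    (fun f _ k => Fin.ofNat (d + 1) (f (some k))) ?_ ?_ ?_ ?_ ?_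
  · intro α hα
    have := (Finset.mem_filter.1 hα).2
    simp [Finset.mem_piAntidiag, Fintype.sum_option, this]
  · intro f hf
    have hs := (Finset.mem_piAntidiag.1 hf).1
    rw [Fintype.sum_option] at hs
    simp only [Finset.mem_filter, Finset.mem_univ, true_and, Fin.val_ofNat]
    calc _ ≤ ∑ k, f (some k) := Finset.sum_le_sum fun k _ => Nat.mod_le _ _
      _ ≤ d := by omega
  · intro α _
    funext k
    ext
    simp
  · intro f hf
    have hs := (Finset.mem_piAntidiag.1 hf).1
    rw [Fintype.sum_option] at hs
    have hk : ∀ k, f (some k) % (d + 1) = f (some k) := fun k => by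
      refine Nat.mod_eq_of_lt ?_
      have := Finset.single_le_sum (f := fun k => f (some k)) (fun i _ => Nat.zero_le _)
        (Finset.mem_univ k)
      omega
    funext o
    cases o with
    | none =>
      simp only [Option.elim, Fin.val_ofNat, hk]
      omega
    | some k => simp [hk]
  · intro α hα
    have hα := (Finset.mem_filter.1 hα).2
    have hspec := Nat.multinomial_spec (Finset.univ : Finset (Option (Fin m)))
      (fun o => o.elim (d - ∑ k, (α k : ℕ)) fun k => (α k : ℕ))
    simp only [Fintype.sum_option, Fintype.prod_option, Option.elim, Nat.sub_add_cancel hα]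
      at hspec
    simp only [Fintype.prod_option, Option.elim, one_pow, one_mul, mon, if_pos hα]
    congr 1
    simp only [multinomialVar, if_pos hα]
    push_cast
    rw [← hspec]
    have h3 : ((d - ∑ k, (α k : ℕ)).factorial : ℝ) ≠ 0 := by
      exact_mod_cast Nat.factorial_ne_zero _
    have h4 : ∏ k, ((α k : ℕ).factorial : ℝ) ≠ 0 :=
      Finset.prod_ne_zero_iff.2 fun k _ => by exact_mod_cast Nat.factorial_ne_zero _
    push_cast
    rw [mul_div_assoc, mul_comm, div_mul_cancel₀]
    exact mul_ne_zero h3 h4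

theorem sum_multinomialVar_mul_sq {m : ℕ} (e : ℕ) (s : ℝ) (x ξ : Fin m → ℝ) :
    ∑ α : Fin m → Fin (e + 1 + 1),
        multinomialVar (e + 1) α * (s * mon α x + fderiv ℝ (mon α) x ξ) ^ 2 =
      (1 + ∑ k, x k ^ 2) ^ (e + 1) * s ^ 2 +
        2 * s * ((e + 1) * (1 + ∑ k, x k ^ 2) ^ e * ∑ k, x k * ξ k) +
        ((e + 1) * (1 + ∑ k, x k ^ 2) ^ e * ∑ k, ξ k ^ 2 +
          (e + 1) * e * (1 + ∑ k, x k ^ 2) ^ (e - 1) * (∑ k, x k * ξ k) ^ 2) := by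
  set D : (Fin m → Fin (e + 1 + 1)) → ℝ := fun α => fderiv ℝ (mon α) x ξ with hD
  have hmon : ∀ α : Fin m → Fin (e + 1 + 1),
      HasDerivAt (fun a : ℝ => mon α (x + a • ξ)) (D α) 0 := by
    intro α
    have h1 : HasFDerivAt (mon α) (fderiv ℝ (mon α) x) (x + (0 : ℝ) • ξ) := by
      rw [zero_smul, add_zero]
      exact ((contDiff_mon α).differentiable (by norm_num) x).hasFDerivAt
    have h2 : HasDerivAt (fun a : ℝ => x + a • ξ) ξ 0 := by
      simpa using ((hasDerivAt_id (0 : ℝ)).smul_const ξ).const_add x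
    exact HasFDerivAt.comp_hasDerivAt (l := mon α) (f := fun a : ℝ => x + a • ξ) 0 h1 h2
  have hlin : ∀ p : Fin m → ℝ, HasDerivAt (fun a : ℝ => ∑ k, p k * (x k + a * ξ k))
      (∑ k, p k * ξ k) 0 := by
    intro p
    refine HasDerivAt.fun_sum fun k _ => HasDerivAt.const_mul _ ?_
    simpa using ((hasDerivAt_id (0 : ℝ)).mul_const (ξ k)).const_add (x k)
  have hF : ∀ a b : ℝ, ∑ α : Fin m → Fin (e + 1 + 1),
      multinomialVar (e + 1) α * (mon α (x + a • ξ) * mon α (x + b • ξ)) =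
        (1 + ∑ k, (x k + a * ξ k) * (x k + b * ξ k)) ^ (e + 1) := by
    intro a b
    rw [← sum_multinomialVar_mul_mon]
    refine Finset.sum_congr rfl fun α _ => ?_
    by_cases h : ∑ k, (α k : ℕ) ≤ e + 1 <;> simp [mon, mul_pow, Finset.prod_mul_distrib, h]
  have hF1 : ∀ a : ℝ, ∑ α : Fin m → Fin (e + 1 + 1),
      multinomialVar (e + 1) α * (mon α (x + a • ξ) * D α) =
        (e + 1) * (1 + ∑ k, x k * (x k + a * ξ k)) ^ e * ∑ k, ξ k * (x k + a * ξ k) := by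
    intro a
    have h1 : HasDerivAt (fun b : ℝ => ∑ α : Fin m → Fin (e + 1 + 1),
        multinomialVar (e + 1) α * (mon α (x + a • ξ) * mon α (x + b • ξ)))
        (∑ α : Fin m → Fin (e + 1 + 1),
          multinomialVar (e + 1) α * (mon α (x + a • ξ) * D α)) 0 :=
      HasDerivAt.fun_sum fun α _ => ((hmon α).const_mul _).const_mul _
    have h2 := ((hlin fun k => x k + a * ξ k).const_add 1).fun_pow (e + 1)
    rw [funext fun b => hF a b] at h1
    rw [h1.unique h2]
    simp [mul_comm]
  have hF2 : ∑ α : Fin m → Fin (e + 1 + 1), multinomialVar (e + 1) α * (D α * D α) =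
      (e + 1) * (1 + ∑ k, x k ^ 2) ^ e * ∑ k, ξ k ^ 2 +
          (e + 1) * e * (1 + ∑ k, x k ^ 2) ^ (e - 1) * (∑ k, x k * ξ k) ^ 2 := by
    have h1 : HasDerivAt (fun a : ℝ => ∑ α : Fin m → Fin (e + 1 + 1),
        multinomialVar (e + 1) α * (mon α (x + a • ξ) * D α))
        (∑ α : Fin m → Fin (e + 1 + 1), multinomialVar (e + 1) α * (D α * D α)) 0 :=
      HasDerivAt.fun_sum fun α _ => ((hmon α).mul_const _).const_mul _
    have h2 := ((((hlin x).const_add 1).fun_pow e).const_mul (e + 1 : ℝ)).fun_mul (hlin ξ)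
    rw [funext hF1] at h1
    rw [h1.unique h2]
    simp only [zero_mul, add_zero, ← pow_two, mul_comm (ξ _) (x _)]
    ring
  have e0 := hF 0 0
  have e1 := hF1 0
  simp only [zero_smul, zero_mul, add_zero, ← pow_two, mul_comm (ξ _) (x _)] at e0 e1
  rw [← hF2, mul_comm ((1 + ∑ k, x k ^ 2) ^ (e + 1)), ← e0, ← e1, Finset.mul_sum, Finset.mul_sum,
    ← Finset.sum_add_distrib, ← Finset.sum_add_distrib]
  exact Finset.sum_congr rfl fun α _ => by ring

theorem lintegral_pi_pi_split {ι : Type*} [Fintype ι] [DecidableEq ι] (m : ℕ) (i₀ : ι)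
    (μ : ι → Measure ℝ) [∀ i, SigmaFinite (μ i)]
    (f : (Fin m → {i // i ≠ i₀} → ℝ) × (Fin m → ℝ) → ℝ≥0∞) :
    ∫⁻ A : Fin m → ι → ℝ, f (fun j i => A j i, fun j => A j i₀)
        ∂(Measure.pi fun _ => Measure.pi μ) =
      ∫⁻ q, f q ∂((Measure.pi fun _ => Measure.pi fun i : {i // i ≠ i₀} => μ i).prod
        (Measure.pi fun _ => μ i₀)) := by
  let _ : Unique {i // ¬ i ≠ i₀} := ⟨⟨⟨i₀, by simp⟩⟩, fun i => Subtype.ext (not_not.1 i.2)⟩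
  let e : (ι → ℝ) ≃ᵐ ({i // i ≠ i₀} → ℝ) × ℝ :=
    (MeasurableEquiv.piEquivPiSubtypeProd (fun _ : ι => ℝ) (fun i => i ≠ i₀)).trans
      (MeasurableEquiv.prodCongr (MeasurableEquiv.refl _)
        (MeasurableEquiv.piUnique fun _ : {i // ¬ i ≠ i₀} => ℝ))
  have he : MeasurePreserving e (Measure.pi μ)
      ((Measure.pi fun i : {i // i ≠ i₀} => μ i).prod (μ i₀)) :=
    ((MeasurePreserving.id _).prod
      (measurePreserving_piUnique fun i : {i // ¬ i ≠ i₀} => μ i)).comp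
      (measurePreserving_piEquivPiSubtypeProd μ fun i => i ≠ i₀)
  let E := (MeasurableEquiv.piCongrRight fun _ : Fin m => e).trans
    (MeasurableEquiv.arrowProdEquivProdArrow ({i // i ≠ i₀} → ℝ) ℝ (Fin m))
  have hE : MeasurePreserving E (Measure.pi fun _ => Measure.pi μ)
      ((Measure.pi fun _ => Measure.pi fun i : {i // i ≠ i₀} => μ i).prod
        (Measure.pi fun _ => μ i₀)) :=
    (measurePreserving_arrowProdEquivProdArrow _ _ _ _ _).comp
      (measurePreserving_pi _ _ fun _ => he)
  exact hE.lintegral_comp_emb E.measurableEmbedding f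

/-- Minus the non-constant part of the polynomial with coefficients `B`. -/
noncomputable def negNonconst {m d : ℕ} (B : {α : Fin m → Fin (d + 1) // α ≠ 0} → ℝ)
    (x : Fin m → ℝ) : ℝ :=
  -∑ α, B α * mon α.1 x

theorem fderiv_negNonconst {m d : ℕ} (B : {α : Fin m → Fin (d + 1) // α ≠ 0} → ℝ)
    (x ξ : Fin m → ℝ) :
    fderiv ℝ (negNonconst B) x ξ = -∑ α, B α * fderiv ℝ (mon α.1) x ξ := by
  have h : HasFDerivAt (negNonconst B) (-∑ α, B α • fderiv ℝ (mon α.1) x) x := by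
    refine (HasFDerivAt.fun_sum fun α _ => HasFDerivAt.const_mul ?_ _).fun_neg
    exact ((contDiff_mon α.1).differentiable (by norm_num) x).hasFDerivAt
  rw [h.fderiv]
  simp

theorem integral_cexp_negNonconst {m e : ℕ} (x : Fin m → ℝ) (s : ℝ) (ξ : Fin m → ℝ) :
    ∫ B : {α : Fin m → Fin (e + 1 + 1) // α ≠ 0} → ℝ,
        Complex.exp ((s * negNonconst B x +
          ∑ k, ξ k * fderiv ℝ (negNonconst B) x (Pi.single k 1) : ℝ) * Complex.I)
        ∂(Measure.pi fun α => gaussianReal 0 (multinomialVar (e + 1) α.1)) =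
      ((rexp (-(((1 + ∑ k, x k ^ 2) ^ (e + 1) - 1) * s ^ 2 +
        2 * s * ((e + 1) * (1 + ∑ k, x k ^ 2) ^ e * ∑ k, x k * ξ k) +
        ((e + 1) * (1 + ∑ k, x k ^ 2) ^ e * ∑ k, ξ k ^ 2 +
          (e + 1) * e * (1 + ∑ k, x k ^ 2) ^ (e - 1) * (∑ k, x k * ξ k) ^ 2)) / 2) : ℝ) : ℂ) := by
  have h := integral_cexp_sum_pi_gaussianReal
    (fun α : {α : Fin m → Fin (e + 1 + 1) // α ≠ 0} => multinomialVar (e + 1) α.1)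
    fun α => -(s * mon α.1 x + fderiv ℝ (mon α.1) x ξ)
  have hξ : ∀ f : (Fin m → ℝ) →L[ℝ] ℝ, ∑ k, ξ k * f (Pi.single k 1) = f ξ := by
    intro f
    conv_rhs => rw [pi_eq_sum_univ' ξ, map_sum]
    refine Finset.sum_congr rfl fun k _ => ?_
    rw [map_smul, smul_eq_mul]
  convert h using 5 with B
  · rw [hξ, fderiv_negNonconst, negNonconst]
    simp only [mul_neg, Finset.mul_sum, ← neg_add, neg_mul, Finset.sum_neg_distrib,
      ← Finset.sum_add_distrib]
    rw [Complex.ofReal_inj, neg_inj]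
    exact Finset.sum_congr rfl fun α _ => by ring
  · have hsum := sum_multinomialVar_mul_sq e s x ξ
    rw [← Finset.add_sum_erase _ _ (Finset.mem_univ (0 : Fin m → Fin (e + 1 + 1))),
      multinomialVar_zero, mon_zero,
      Finset.sum_subtype (p := fun α => α ≠ 0) _ (fun α => by simp)] at hsum
    simp only [neg_sq]
    simp only [fderiv_fun_const, Pi.zero_apply, zero_apply, add_zero, mul_one,
      NNReal.coe_one, one_mul] at hsum
    linarith

theorem lintegral_abs_det_negNonconst {m e : ℕ} (x : Fin m → ℝ) :
    ∫⁻ B : Fin m → {α : Fin m → Fin (e + 1 + 1) // α ≠ 0} → ℝ,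
        ENNReal.ofReal |(Matrix.of fun j k =>
          fderiv ℝ (negNonconst (B j)) x (Pi.single k 1)).det| *
          ∏ j, gaussianPDF 0 1 (negNonconst (B j) x)
        ∂(Measure.pi fun _ => Measure.pi fun α => gaussianReal 0 (multinomialVar (e + 1) α.1)) =
      ENNReal.ofReal (π ^ (-((m : ℝ) + 1) / 2) * Real.Gamma (((m : ℝ) + 1) / 2)
        * ((e + 1 : ℕ) : ℝ) ^ ((m : ℝ) / 2) / (1 + ∑ k, x k ^ 2) ^ (((m : ℝ) + 1) / 2)) := by
  have hu : Measurable fun B : {α : Fin m → Fin (e + 1 + 1) // α ≠ 0} → ℝ =>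
      negNonconst B x := by
    unfold negNonconst
    fun_prop
  have hv : Measurable fun (B : {α : Fin m → Fin (e + 1 + 1) // α ≠ 0} → ℝ) (k : Fin m) =>
      fderiv ℝ (negNonconst B) x (Pi.single k 1) := by
    simp only [fderiv_negNonconst]
    fun_prop
  have hchar := integral_cexp_negNonconst (e := e) x
  set r := 1 + ∑ k, x k ^ 2 with hr
  have hr0 : 0 < r := by
    have : 0 ≤ ∑ k, x k ^ 2 := Finset.sum_nonneg fun k _ => sq_nonneg _
    linarith
  have hmap := map_withDensity_gaussianPDF_eq
    (Measure.pi fun α : {α : Fin m → Fin (e + 1 + 1) // α ≠ 0} =>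
      gaussianReal 0 (multinomialVar (e + 1) α.1)) hu hv (pow_pos hr0 (e + 1))
    (c := fun ξ => (e + 1) * r ^ e * ∑ k, x k * ξ k)
    (M := fun ξ => (e + 1) * r ^ e * ∑ k, ξ k ^ 2 +
      (e + 1) * e * r ^ (e - 1) * (∑ k, x k * ξ k) ^ 2)
    (L := √((e + 1) * r ^ e) • sqrtProj x) hchar ?_
  · refine (lintegral_abs_det_mul_prod_gaussianPDF _ hu hv hmap).trans ?_
    have hpos : (0 : ℝ) < e + 1 := by positivity
    rw [Matrix.det_smul, det_sqrtProj, ← hr, Fintype.card_fin]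
    have h1 : ENNReal.ofReal (√(2 * π * r ^ (e + 1)))⁻¹ ^ m *
        ENNReal.ofReal |√((e + 1) * r ^ e) ^ m * (√r)⁻¹| =
        ENNReal.ofReal (√(2 * π))⁻¹ ^ m *
          ENNReal.ofReal ((e + 1 : ℝ) ^ ((m : ℝ) / 2) / r ^ (((m : ℝ) + 1) / 2)) := by
      rw [← ENNReal.ofReal_pow (by positivity), ← ENNReal.ofReal_pow (by positivity),
        ← ENNReal.ofReal_mul (by positivity), ← ENNReal.ofReal_mul (by positivity),
        abs_of_nonneg (by positivity)]
      congr 1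
      have h2 : (e + 1 : ℝ) ^ ((m : ℝ) / 2) = √(e + 1) ^ m := by
        rw [Real.sqrt_eq_rpow, ← Real.rpow_natCast, ← Real.rpow_mul hpos.le]
        congr 1
        ring
      have h3 : r ^ (((m : ℝ) + 1) / 2) = √r ^ (m + 1) := by
        rw [Real.sqrt_eq_rpow, ← Real.rpow_natCast, ← Real.rpow_mul hr0.le]
        congr 1
        push_cast
        ring
      rw [h2, h3, Real.sqrt_mul (by positivity) (r ^ (e + 1)), Real.sqrt_mul hpos.le,
        pow_succ r e, Real.sqrt_mul (by positivity) r]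
      have := Real.sqrt_pos.2 hr0
      have := Real.sqrt_pos.2 (pow_pos hr0 e)
      have := Real.sqrt_pos.2 (show (0 : ℝ) < 2 * π by positivity)
      simp only [mul_pow, mul_inv, pow_succ, inv_pow]
      field_simp
    rw [h1, mul_right_comm, gaussianAbsDet_eq, ← ENNReal.ofReal_mul
      (div_nonneg (Real.Gamma_nonneg_of_nonneg (by positivity)) (by positivity))]
    congr 1
    rw [neg_div, Real.rpow_neg pi_pos.le]
    push_cast
    ring
  · intro ξ
    have h1 : ∀ l, Matrix.vecMul ξ (√((e + 1) * r ^ e) • sqrtProj x) l =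
        √((e + 1) * r ^ e) * Matrix.vecMul ξ (sqrtProj x) l := fun l => by
      rw [Matrix.vecMul_smul]
      rfl
    simp only [h1, mul_pow]
    rw [← Finset.mul_sum, sum_vecMul_sqrtProj_sq, ← hr, Real.sq_sqrt (by positivity)]
    rcases e with _ | e
    · simp
    · simp only [Nat.add_sub_cancel]
      push_cast
      field_simp
      ring

theorem lintegral_encard_zeros {m e : ℕ} {I : Set (Fin m → ℝ)} (hI : MeasurableSet I) :
    ∫⁻ A : Fin m → (Fin m → Fin (e + 1 + 1)) → ℝ,
        ({x : Fin m → ℝ | x ∈ I ∧ ∀ j : Fin m,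
          (∑ α ∈ Finset.univ.filter
              (fun α : Fin m → Fin (e + 1 + 1) => ∑ k, (α k : ℕ) ≤ e + 1),
            A j α * ∏ k, x k ^ (α k : ℕ)) = 0}.encard : ℝ≥0∞)
        ∂(Measure.pi fun _ => Measure.pi fun α => gaussianReal 0 (multinomialVar (e + 1) α)) =
      ∫⁻ t in I, ENNReal.ofReal (π ^ (-((m : ℝ) + 1) / 2) * Real.Gamma (((m : ℝ) + 1) / 2)
        * ((e + 1 : ℕ) : ℝ) ^ ((m : ℝ) / 2) / (1 + ∑ k, t k ^ 2) ^ (((m : ℝ) + 1) / 2)) := by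
  let Ω := Fin m → {α : Fin m → Fin (e + 1 + 1) // α ≠ 0} → ℝ
  let g : Ω × (Fin m → ℝ) → Fin m → ℝ := fun p j => negNonconst (p.1 j) p.2
  have hg : ContDiff ℝ 1 g := by
    refine contDiff_pi.2 fun j => ContDiff.neg (ContDiff.sum fun α _ => ContDiff.mul ?_ ?_)
    · fun_prop
    · exact ((contDiff_mon α.1).of_le (by norm_num)).comp contDiff_snd
  have hgx : ∀ p : Ω × (Fin m → ℝ), DifferentiableAt ℝ (fun x => g (p.1, x)) p.2 := fun p =>
    (hg.comp (contDiff_prodMk_right p.1)).differentiable (by norm_num) p.2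
  have hzero : ∀ A : Fin m → (Fin m → Fin (e + 1 + 1)) → ℝ,
      {x : Fin m → ℝ | x ∈ I ∧ ∀ j : Fin m,
        (∑ α ∈ Finset.univ.filter
            (fun α : Fin m → Fin (e + 1 + 1) => ∑ k, (α k : ℕ) ≤ e + 1),
          A j α * ∏ k, x k ^ (α k : ℕ)) = 0} =
      {x | x ∈ I ∧ g (fun j α => A j α, x) = fun j => A j 0} := by
    intro A
    ext x
    simp only [mem_ofPred_eq, funext_iff]
    refine and_congr_right fun _ => forall_congr' fun j => ?_
    have h1 : ∑ α ∈ Finset.univ.filter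
        (fun α : Fin m → Fin (e + 1 + 1) => ∑ k, (α k : ℕ) ≤ e + 1),
          A j α * ∏ k, x k ^ (α k : ℕ) = A j 0 - g (fun j α => A j α, x) j := by
      rw [Finset.sum_filter]
      have h2 : ∀ α : Fin m → Fin (e + 1 + 1), (if ∑ k, (α k : ℕ) ≤ e + 1 then
          A j α * ∏ k, x k ^ (α k : ℕ) else 0) = A j α * mon α x := by
        intro α
        simp only [mon, mul_ite, mul_zero]
      simp only [h2]
      rw [← Finset.add_sum_erase _ _ (Finset.mem_univ (0 : Fin m → Fin (e + 1 + 1))), mon_zero,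
        Finset.sum_subtype (p := fun α => α ≠ 0) (F := inferInstance) _ (fun α => by simp)]
      simp [g, negNonconst]
    rw [h1, sub_eq_zero, eq_comm]
  simp only [hzero]
  rw [lintegral_pi_pi_split m (0 : Fin m → Fin (e + 1 + 1)) (fun α =>
    gaussianReal 0 (multinomialVar (e + 1) α))
    fun q => ({x | x ∈ I ∧ g (q.1, x) = q.2}.encard : ℝ≥0∞), multinomialVar_zero,
    pi_gaussianReal_eq_withDensity,
    lintegral_encard_fiber volume _ (measurable_prod_gaussianPDF m) hg
      (fun p => (hgx p).hasFDerivAt) hI]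
  refine lintegral_congr fun x => ?_
  rw [← lintegral_abs_det_negNonconst]
  refine lintegral_congr fun B => ?_
  congr 4
  rw [ContinuousLinearMap.det, ← LinearMap.det_toMatrix']
  congr 1
  ext j k
  rw [LinearMap.toMatrix'_apply]
  have h3 := (hasFDerivAt_pi'.1 (hgx (B, x)).hasFDerivAt j).fderiv
  simp only [Matrix.of_apply]
  exact (DFunLike.congr_fun h3 (Pi.single k 1)).symm

/-- Section 7.2: a system of `m` independent random polynomials of degree `d` in `m`
variables, whose coefficients are independent centered normals with variances the
multinomial coefficients `d!/((d-Σᵢ iₖ)!·∏ₖ iₖ!)`, has `d^{m/2}` expected real zeros;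
the density of zeros at `t ∈ ℝᵐ` is
`π^{-(m+1)/2} Γ((m+1)/2) d^{m/2} / (1 + t·t)^{(m+1)/2}`.
Multi-indices are modelled as `α : Fin m → Fin (d+1)` with `Σ α ≤ d`. -/
theorem shub_smale_random_system (m d : ℕ) (hm : 1 ≤ m) (hd : 1 ≤ d) :
    (∀ I : Set (Fin m → ℝ), MeasurableSet I →
      ∫⁻ A : Fin m → (Fin m → Fin (d + 1)) → ℝ,
          ({x : Fin m → ℝ | x ∈ I ∧ ∀ j : Fin m,
            (∑ α ∈ Finset.univ.filter
                (fun α : Fin m → Fin (d + 1) => ∑ k, (α k : ℕ) ≤ d),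
              A j α * ∏ k, x k ^ (α k : ℕ)) = 0}.encard : ℝ≥0∞)
          ∂(Measure.pi fun _ => Measure.pi fun α =>
              gaussianReal 0
                (if ∑ k, (α k : ℕ) ≤ d then
                  (d.factorial : ℝ≥0) /
                    (((d - ∑ k, (α k : ℕ)).factorial : ℝ≥0) *
                      ∏ k, ((α k : ℕ).factorial : ℝ≥0))
                 else 0))
        = ∫⁻ t in I, ENNReal.ofReal
            (π ^ (-((m : ℝ) + 1) / 2) * Real.Gamma (((m : ℝ) + 1) / 2)
              * (d : ℝ) ^ ((m : ℝ) / 2)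
              / (1 + ∑ k, t k ^ 2) ^ (((m : ℝ) + 1) / 2))) ∧
    ∫⁻ A : Fin m → (Fin m → Fin (d + 1)) → ℝ,
        ({x : Fin m → ℝ | ∀ j : Fin m,
          (∑ α ∈ Finset.univ.filter
              (fun α : Fin m → Fin (d + 1) => ∑ k, (α k : ℕ) ≤ d),
            A j α * ∏ k, x k ^ (α k : ℕ)) = 0}.encard : ℝ≥0∞)
        ∂(Measure.pi fun _ => Measure.pi fun α =>
            gaussianReal 0
              (if ∑ k, (α k : ℕ) ≤ d then
                (d.factorial : ℝ≥0) /
                  (((d - ∑ k, (α k : ℕ)).factorial : ℝ≥0) *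
                    ∏ k, ((α k : ℕ).factorial : ℝ≥0))
               else 0))
      = ENNReal.ofReal ((d : ℝ) ^ ((m : ℝ) / 2)) := by
  obtain ⟨e, rfl⟩ : ∃ e, d = e + 1 := ⟨d - 1, by omega⟩
  refine ⟨fun I hI => lintegral_encard_zeros hI, ?_⟩
  have h := lintegral_encard_zeros (m := m) (e := e) MeasurableSet.univ
  simp only [mem_univ, true_and] at h
  refine h.trans ?_
  have hΓ : 0 < Real.Gamma (((m : ℝ) + 1) / 2) := Real.Gamma_pos_of_pos (by positivity)
  have hdens : ∀ t : Fin m → ℝ, ENNReal.ofReal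
      (π ^ (-((m : ℝ) + 1) / 2) * Real.Gamma (((m : ℝ) + 1) / 2)
        * ((e + 1 : ℕ) : ℝ) ^ ((m : ℝ) / 2) / (1 + ∑ k, t k ^ 2) ^ (((m : ℝ) + 1) / 2)) =
      ENNReal.ofReal (π ^ (-((m : ℝ) + 1) / 2) * Real.Gamma (((m : ℝ) + 1) / 2)
        * ((e + 1 : ℕ) : ℝ) ^ ((m : ℝ) / 2)) *
        ENNReal.ofReal ((1 + ∑ k, t k ^ 2) ^ (-((m + 1) / 2 : ℝ))) := by
    intro t
    have : 0 ≤ ∑ k, t k ^ 2 := Finset.sum_nonneg fun k _ => sq_nonneg _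
    rw [← ENNReal.ofReal_mul (by positivity), Real.rpow_neg (by positivity), div_eq_mul_inv]
  simp only [hdens, Measure.restrict_univ]
  rw [lintegral_const_mul' _ _ ENNReal.ofReal_ne_top, lintegral_one_add_sum_sq_rpow,
    ← ENNReal.ofReal_mul (by positivity)]
  congr 1
  rw [neg_div, Real.rpow_neg pi_pos.le]
  have : π ^ (((m : ℝ) + 1) / 2) ≠ 0 := (Real.rpow_pos_of_pos pi_pos _).ne'
  field_simp
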